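/- Let d ≥ 1, h > 0, m_h := max(−1, 1−h²). Then for every x ∈ [m_h, 1], ∫_{m_h}^x (1 − (1−t)/h²)(1−t²)^{d/2−1} dt = h^{−2} [ (h²−1)·(ω_d/ω_{d−1})·(F_d(x) − F_d(m_h)) − (1/d)·((1−x²)^{d/2} − (1−m_h²)^{d/2}) ]. Consequently, the cumulative distribution function of the cosine T = Y'μ of a random point Y drawn from the normalized Epanechnikov kernel L_{h,Epa}(·,μ) on S^d is F_{d,Epa,h}(x) = ω_{d−1} c_{d,L_Epa}(h) h^{−2} [ (h²−1)(ω_d/ω_{d−1})(F_d(x) − F_d(m_h)) − (1/d)((1−x²)^{d/2} − (1−m_h²)^{d/2}) ] for x ∈ [m_h, 1]. -/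

import Mathlib

/-!
Proposition 2: angular cdf of the Epanechnikov kernel on `S^d`.
-/

noncomputable section

/-- Surface area `ω_m = 2 π^{(m+1)/2} / Γ((m+1)/2)` of `S^m` (real parameter `m`). -/
def sphereArea (m : ℝ) : ℝ := 2 * Real.pi ^ ((m + 1) / 2) / Real.Gamma ((m + 1) / 2)

/-- The cdf `F_d` of `γ'X` for `X ∼ Unif(S^d)`. -/
def projUnifCDF (d : ℕ) (x : ℝ) : ℝ :=
  sphereArea ((d : ℝ) - 1) / sphereArea (d : ℝ) *
    ∫ t in (-1 : ℝ)..x, (1 - t ^ 2) ^ ((d : ℝ) / 2 - 1)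

/-- The Epanechnikov kernel `L_Epa(t) = (1-t)·1{0 ≤ t ≤ 1}`. -/
def epaKernel (t : ℝ) : ℝ := if 0 ≤ t ∧ t ≤ 1 then 1 - t else 0

theorem sphereArea_pos {a : ℝ} (ha : -1 < a) : 0 < sphereArea a := by
  have hΓ : 0 < Real.Gamma ((a + 1) / 2) := Real.Gamma_pos_of_pos (by linarith)
  unfold sphereArea
  positivity

theorem intervalIntegrable_inv_sqrt_one_sub_sq :
    IntervalIntegrable (fun t : ℝ => 1 / √(1 - t ^ 2)) MeasureTheory.volume (-1) 1 := by
  refine intervalIntegral.intervalIntegrable_deriv_of_nonneg (g := Real.arcsin)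
    Real.continuous_arcsin.continuousOn (fun t ht => ?_) (fun t _ => by positivity)
  rw [min_eq_left (by norm_num), max_eq_right (by norm_num)] at ht
  exact Real.hasDerivAt_arcsin ht.1.ne' ht.2.ne

theorem intervalIntegrable_one_sub_sq_rpow {a : ℝ} (ha : -1 / 2 ≤ a) :
    IntervalIntegrable (fun t : ℝ => (1 - t ^ 2) ^ a) MeasureTheory.volume (-1) 1 := by
  refine intervalIntegrable_inv_sqrt_one_sub_sq.mono_fun
    (Measurable.aestronglyMeasurable (by fun_prop)) ?_
  rw [Set.uIoc_of_le (by norm_num), ← MeasureTheory.restrict_Ioo_eq_restrict_Ioc]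
  filter_upwards [MeasureTheory.ae_restrict_mem measurableSet_Ioo] with t ht
  have hpos : 0 < 1 - t ^ 2 := by nlinarith [ht.1, ht.2]
  rw [Real.norm_of_nonneg (by positivity), Real.norm_of_nonneg (by positivity),
    Real.sqrt_eq_rpow, one_div, ← Real.rpow_neg hpos.le]
  exact Real.rpow_le_rpow_of_exponent_ge hpos (by nlinarith [sq_nonneg t]) (by linarith)

theorem integral_mul_one_sub_sq_rpow {p a b : ℝ} (hp : 1 / 2 ≤ p) (ha : -1 ≤ a) (hab : a ≤ b)
    (hb : b ≤ 1) :
    ∫ t in a..b, t * (1 - t ^ 2) ^ (p - 1)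
      = -(1 / (2 * p)) * ((1 - b ^ 2) ^ p - (1 - a ^ 2) ^ p) := by
  have hp0 : 0 < p := by linarith
  have hint : IntervalIntegrable (fun t : ℝ => t * (1 - t ^ 2) ^ (p - 1))
      MeasureTheory.volume a b := by
    refine ((intervalIntegrable_one_sub_sq_rpow (a := p - 1) (by linarith)).mono_set
      ?_).continuousOn_mul continuousOn_id
    rw [Set.uIcc_of_le hab, Set.uIcc_of_le (by norm_num)]
    exact Set.Icc_subset_Icc ha hb
  have hcont : ContinuousOn (fun t : ℝ => -(1 / (2 * p)) * (1 - t ^ 2) ^ p) (Set.Icc a b) :=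
    ((Continuous.rpow_const (by fun_prop) fun _ => Or.inr hp0.le).const_mul _).continuousOn
  rw [intervalIntegral.integral_eq_sub_of_hasDerivAt_of_le hab hcont (fun t ht => ?_) hint]
  · ring
  have hpos : 0 < 1 - t ^ 2 := by nlinarith [ht.1, ht.2]
  have hderiv := (((hasDerivAt_pow 2 t).const_sub 1).rpow_const (p := p)
    (Or.inl hpos.ne')).const_mul (-(1 / (2 * p)))
  refine hderiv.congr_deriv ?_
  push_cast
  field_simp

theorem projUnifCDF_sub_projUnifCDF {d : ℕ} (hd : 1 ≤ d) {a b : ℝ} (ha : a ∈ Set.Icc (-1) 1)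
    (hb : b ∈ Set.Icc (-1) 1) :
    sphereArea d / sphereArea ((d : ℝ) - 1) * (projUnifCDF d b - projUnifCDF d a)
      = ∫ t in a..b, (1 - t ^ 2) ^ ((d : ℝ) / 2 - 1) := by
  have hd1 : (1 : ℝ) ≤ d := by exact_mod_cast hd
  have hω := (sphereArea_pos (a := d) (by linarith)).ne'
  have hω' := (sphereArea_pos (a := (d : ℝ) - 1) (by linarith)).ne'
  have hint : ∀ y ∈ Set.Icc (-1 : ℝ) 1, IntervalIntegrable
      (fun t : ℝ => (1 - t ^ 2) ^ ((d : ℝ) / 2 - 1)) MeasureTheory.volume (-1) y := fun y hy => by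
    refine (intervalIntegrable_one_sub_sq_rpow (by linarith)).mono_set ?_
    rw [Set.uIcc_of_le hy.1, Set.uIcc_of_le (by norm_num)]
    exact Set.Icc_subset_Icc_right hy.2
  rw [← intervalIntegral.integral_interval_sub_left (hint b hb) (hint a ha)]
  unfold projUnifCDF
  field_simp

theorem integral_epanechnikov_angular {d : ℕ} (hd : 1 ≤ d) {h a b : ℝ} (hh : h ≠ 0)
    (ha : -1 ≤ a) (hab : a ≤ b) (hb : b ≤ 1) :
    (∫ t in a..b, (1 - (1 - t) / h ^ 2) * (1 - t ^ 2) ^ ((d : ℝ) / 2 - 1))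
      = (h ^ 2)⁻¹ *
          ((h ^ 2 - 1) * (sphereArea (d : ℝ) / sphereArea ((d : ℝ) - 1)) *
              (projUnifCDF d b - projUnifCDF d a)
            - (1 / d) * ((1 - b ^ 2) ^ ((d : ℝ) / 2) - (1 - a ^ 2) ^ ((d : ℝ) / 2))) := by
  have hd1 : (1 : ℝ) ≤ d := by exact_mod_cast hd
  have hint : IntervalIntegrable (fun t : ℝ => (1 - t ^ 2) ^ ((d : ℝ) / 2 - 1))
      MeasureTheory.volume a b := by
    refine (intervalIntegrable_one_sub_sq_rpow (by linarith)).mono_set ?_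
    rw [Set.uIcc_of_le hab, Set.uIcc_of_le (by norm_num)]
    exact Set.Icc_subset_Icc ha hb
  have hsplit : ∀ t : ℝ, (1 - (1 - t) / h ^ 2) * (1 - t ^ 2) ^ ((d : ℝ) / 2 - 1)
      = (h ^ 2)⁻¹ * ((h ^ 2 - 1) * (1 - t ^ 2) ^ ((d : ℝ) / 2 - 1)
        + t * (1 - t ^ 2) ^ ((d : ℝ) / 2 - 1)) := fun t => by
    field_simp
    ring
  simp_rw [hsplit]
  rw [intervalIntegral.integral_const_mul,
    intervalIntegral.integral_add (hint.const_mul _) (hint.continuousOn_mul (continuousOn_id' _)),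
    intervalIntegral.integral_const_mul,
    integral_mul_one_sub_sq_rpow (by linarith) ha hab hb,
    mul_assoc (h ^ 2 - 1), projUnifCDF_sub_projUnifCDF hd ⟨ha, hab.trans hb⟩ ⟨ha.trans hab, hb⟩]
  ring

theorem epanechnikov_angular_cdf
    (d : ℕ) (hd : 1 ≤ d) (h : ℝ) (hh : 0 < h) (m : ℝ) (hm : m = max (-1) (1 - h ^ 2))
    -- the normalizing constant `c_{d,L_Epa}(h)`
    (c : ℝ)
    (hc : c = (sphereArea ((d : ℝ) - 1) *
      ∫ t in (-1 : ℝ)..1, epaKernel ((1 - t) / h ^ 2) * (1 - t ^ 2) ^ ((d : ℝ) / 2 - 1))⁻¹) :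
    ∀ x ∈ Set.Icc m 1,
      (∫ t in m..x, (1 - (1 - t) / h ^ 2) * (1 - t ^ 2) ^ ((d : ℝ) / 2 - 1))
        = (h ^ 2)⁻¹ *
            ((h ^ 2 - 1) * (sphereArea (d : ℝ) / sphereArea ((d : ℝ) - 1)) *
                (projUnifCDF d x - projUnifCDF d m)
              - (1 / d) * ((1 - x ^ 2) ^ ((d : ℝ) / 2) - (1 - m ^ 2) ^ ((d : ℝ) / 2))) ∧
      -- the cdf of `T = Y'μ` for `Y ∼ L_{h,Epa}(·,μ)`
      (∫ t in m..x,
          sphereArea ((d : ℝ) - 1) * c * (1 - (1 - t) / h ^ 2) *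
            (1 - t ^ 2) ^ ((d : ℝ) / 2 - 1) * (if m < t ∧ t < 1 then 1 else 0))
        = sphereArea ((d : ℝ) - 1) * c * (h ^ 2)⁻¹ *
            ((h ^ 2 - 1) * (sphereArea (d : ℝ) / sphereArea ((d : ℝ) - 1)) *
                (projUnifCDF d x - projUnifCDF d m)
              - (1 / d) * ((1 - x ^ 2) ^ ((d : ℝ) / 2) - (1 - m ^ 2) ^ ((d : ℝ) / 2))) := by
  rintro x ⟨hmx, hx1⟩
  have hm1 : -1 ≤ m := hm ▸ le_max_left _ _
  have key := integral_epanechnikov_angular hd hh.ne' hm1 hmx hx1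
  refine ⟨key, ?_⟩
  rw [mul_assoc _ (h ^ 2)⁻¹, ← key, ← intervalIntegral.integral_const_mul]
  rw [intervalIntegral.integral_of_le hmx, intervalIntegral.integral_of_le hmx,
    MeasureTheory.integral_Ioc_eq_integral_Ioo, MeasureTheory.integral_Ioc_eq_integral_Ioo]
  refine MeasureTheory.setIntegral_congr_fun measurableSet_Ioo fun t ht => ?_
  simp only [if_pos (show m < t ∧ t < 1 from ⟨ht.1, ht.2.trans_le hx1⟩)]
  ring
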